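/- Let a, b ∈ ℝ and let m ≥ 1 be an integer. For every ε > 0 there exists a constant c > 0, depending only on a, b, m and ε, such that for every smooth periodic function u : ℝ² → ℝ, |(A^m u, A^m f(u))| ≤ ε ‖A^{m+1}u‖² + c(‖A^m u‖² + ‖u‖^{2(2m+3)} + 1), where f(u) = (a+3)u − 4Au + b|∇u|² + u³. -/

import Mathlib

open MeasureTheory Real Filter

noncomputable section

/-- A function `u : ℝ² → ℝ` is smooth periodic if it is `C^∞` and `2π`-periodic
in each variable. -/
def SmoothPeriodic (u : ℝ × ℝ → ℝ) : Prop :=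
  ContDiff ℝ (⊤ : ℕ∞) u ∧ (∀ x y, u (x + 2 * Real.pi, y) = u (x, y)) ∧
    (∀ x y, u (x, y + 2 * Real.pi) = u (x, y))

/-- Partial derivative in the first variable. -/
def pdx (u : ℝ × ℝ → ℝ) : ℝ × ℝ → ℝ := fun p => fderiv ℝ u p (1, 0)

/-- Partial derivative in the second variable. -/
def pdy (u : ℝ × ℝ → ℝ) : ℝ × ℝ → ℝ := fun p => fderiv ℝ u p (0, 1)

/-- The fundamental domain `[0, 2π]²`. -/
def sq2 : Set (ℝ × ℝ) := Set.Icc (0 : ℝ) (2 * Real.pi) ×ˢ Set.Icc (0 : ℝ) (2 * Real.pi)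

/-- The `L²` inner product over `[0, 2π]²`. -/
def l2inner (u v : ℝ × ℝ → ℝ) : ℝ := ∫ p in sq2, u p * v p

/-- The `L²` norm over `[0, 2π]²`. -/
def l2norm (u : ℝ × ℝ → ℝ) : ℝ := Real.sqrt (∫ p in sq2, (u p) ^ 2)

/-- The `L^q` norm over `[0, 2π]²`. -/
def lpnorm (q : ℝ) (u : ℝ × ℝ → ℝ) : ℝ := (∫ p in sq2, |u p| ^ q) ^ (1 / q)

/-- The operator `A = -Δ + 1`. -/
def Aop (u : ℝ × ℝ → ℝ) : ℝ × ℝ → ℝ :=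
  fun p => -(pdx (pdx u) p + pdy (pdy u) p) + u p

/-- The pointwise dot product of gradients, `∇v ⋅ ∇w`. -/
def gradDot (v w : ℝ × ℝ → ℝ) : ℝ × ℝ → ℝ :=
  fun p => pdx v p * pdx w p + pdy v p * pdy w p

/-- The nonlinearity `f(u) = (a+3)u − 4Au + b|∇u|² + u³`. -/
def fNL (a b : ℝ) (u : ℝ × ℝ → ℝ) : ℝ × ℝ → ℝ :=
  fun p => (a + 3) * u p - 4 * Aop u p + b * gradDot u u p + (u p) ^ 3

namespace SmoothPeriodic

variable {u v : ℝ × ℝ → ℝ}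

theorem differentiable (hu : SmoothPeriodic u) : Differentiable ℝ u :=
  hu.1.differentiable (by simp)

theorem continuous (hu : SmoothPeriodic u) : Continuous u := hu.1.continuous

theorem add (hu : SmoothPeriodic u) (hv : SmoothPeriodic v) : SmoothPeriodic (u + v) :=
  ⟨hu.1.add hv.1, fun x y => by simp [hu.2.1, hv.2.1], fun x y => by simp [hu.2.2, hv.2.2]⟩

theorem mul (hu : SmoothPeriodic u) (hv : SmoothPeriodic v) : SmoothPeriodic (u * v) :=
  ⟨hu.1.mul hv.1, fun x y => by simp [hu.2.1, hv.2.1], fun x y => by simp [hu.2.2, hv.2.2]⟩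

theorem neg (hu : SmoothPeriodic u) : SmoothPeriodic (-u) :=
  ⟨hu.1.neg, fun x y => by simp [hu.2.1], fun x y => by simp [hu.2.2]⟩

theorem const_smul (c : ℝ) (hu : SmoothPeriodic u) : SmoothPeriodic (c • u) :=
  ⟨hu.1.const_smul c, fun x y => by simp [hu.2.1], fun x y => by simp [hu.2.2]⟩

theorem fderiv_apply (hu : SmoothPeriodic u) (e : ℝ × ℝ) :
    SmoothPeriodic fun p => fderiv ℝ u p e := by
  refine ⟨(hu.1.fderiv_right (m := (⊤ : ℕ∞)) (by simp)).clm_apply contDiff_const,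
    fun x y => ?_, fun x y => ?_⟩
  · have h : (fun p : ℝ × ℝ => u (p + (2 * π, 0))) = u := by
      funext p
      exact (congrArg u (by ext <;> simp)).trans (hu.2.1 p.1 p.2)
    have := fderiv_comp_add_right (𝕜 := ℝ) (f := u) (x := (x, y)) (2 * π, 0)
    rw [h] at this
    simp [this]
  · have h : (fun p : ℝ × ℝ => u (p + (0, 2 * π))) = u := by
      funext p
      exact (congrArg u (by ext <;> simp)).trans (hu.2.2 p.1 p.2)
    have := fderiv_comp_add_right (𝕜 := ℝ) (f := u) (x := (x, y)) (0, 2 * π)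
    rw [h] at this
    simp [this]

theorem pdx (hu : SmoothPeriodic u) : SmoothPeriodic (pdx u) := hu.fderiv_apply _

theorem pdy (hu : SmoothPeriodic u) : SmoothPeriodic (pdy u) := hu.fderiv_apply _

theorem aop (hu : SmoothPeriodic u) : SmoothPeriodic (Aop u) :=
  (hu.pdx.pdx.add hu.pdy.pdy).neg.add hu

theorem aop_iterate (hu : SmoothPeriodic u) (n : ℕ) : SmoothPeriodic (Aop^[n] u) := by
  induction n with
  | zero => exact hu
  | succ n ih => rw [Function.iterate_succ_apply']; exact ih.aop

theorem gradDot (hu : SmoothPeriodic u) (hv : SmoothPeriodic v) :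
    SmoothPeriodic (gradDot u v) :=
  (hu.pdx.mul hv.pdx).add (hu.pdy.mul hv.pdy)

end SmoothPeriodic

section Derivatives

variable {u v : ℝ × ℝ → ℝ}

theorem pdx_add (hu : SmoothPeriodic u) (hv : SmoothPeriodic v) :
    pdx (u + v) = pdx u + pdx v := by
  funext p
  simp [pdx, fderiv_add (hu.differentiable p) (hv.differentiable p)]

theorem pdy_add (hu : SmoothPeriodic u) (hv : SmoothPeriodic v) :
    pdy (u + v) = pdy u + pdy v := by
  funext p
  simp [pdy, fderiv_add (hu.differentiable p) (hv.differentiable p)]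

theorem pdx_neg (u : ℝ × ℝ → ℝ) : pdx (-u) = -pdx u := by
  funext p
  simp [pdx, fderiv_neg]

theorem pdy_neg (u : ℝ × ℝ → ℝ) : pdy (-u) = -pdy u := by
  funext p
  simp [pdy, fderiv_neg]

theorem pdx_const_smul (c : ℝ) (hu : SmoothPeriodic u) : pdx (c • u) = c • pdx u := by
  funext p
  simp [pdx, fderiv_const_smul (hu.differentiable p)]

theorem pdy_const_smul (c : ℝ) (hu : SmoothPeriodic u) : pdy (c • u) = c • pdy u := by
  funext p
  simp [pdy, fderiv_const_smul (hu.differentiable p)]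

theorem pdx_mul (hu : SmoothPeriodic u) (hv : SmoothPeriodic v) :
    pdx (u * v) = pdx u * v + u * pdx v := by
  funext p
  simp [pdx, fderiv_mul (hu.differentiable p) (hv.differentiable p)]
  ring

theorem pdy_mul (hu : SmoothPeriodic u) (hv : SmoothPeriodic v) :
    pdy (u * v) = pdy u * v + u * pdy v := by
  funext p
  simp [pdy, fderiv_mul (hu.differentiable p) (hv.differentiable p)]
  ring

theorem pdx_pdy_comm (hu : SmoothPeriodic u) : pdx (pdy u) = pdy (pdx u) := by
  funext p
  have hd : DifferentiableAt ℝ (fderiv ℝ u) p :=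
    ((hu.1.fderiv_right (m := (⊤ : ℕ∞)) (by simp)).differentiable (by simp)) p
  have hs : IsSymmSndFDerivAt ℝ u p :=
    hu.1.contDiffAt.isSymmSndFDerivAt <| by
      rw [minSmoothness_of_isRCLikeNormedField]
      exact WithTop.coe_le_coe.2 (le_top : (2 : ℕ∞) ≤ ⊤)
  have key : ∀ e e' : ℝ × ℝ,
      fderiv ℝ (fun q => fderiv ℝ u q e) p e' = fderiv ℝ (fderiv ℝ u) p e' e := by
    intro e e'
    rw [fderiv_clm_apply hd (differentiableAt_const e)]
    simp
  exact (key _ _).trans ((hs.eq _ _).trans (key _ _).symm)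

theorem aop_add (hu : SmoothPeriodic u) (hv : SmoothPeriodic v) :
    Aop (u + v) = Aop u + Aop v := by
  funext p
  simp only [Aop, pdx_add hu hv, pdy_add hu hv, pdx_add hu.pdx hv.pdx, pdy_add hu.pdy hv.pdy,
    Pi.add_apply]
  ring

theorem aop_const_smul (c : ℝ) (hu : SmoothPeriodic u) : Aop (c • u) = c • Aop u := by
  funext p
  simp only [Aop, pdx_const_smul c hu, pdy_const_smul c hu, pdx_const_smul c hu.pdx,
    pdy_const_smul c hu.pdy, Pi.smul_apply, smul_eq_mul]
  ring

theorem aop_iterate_add (n : ℕ) (hu : SmoothPeriodic u) (hv : SmoothPeriodic v) :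
    Aop^[n] (u + v) = Aop^[n] u + Aop^[n] v := by
  induction n with
  | zero => rfl
  | succ n ih =>
    simp only [Function.iterate_succ_apply', ih, aop_add (hu.aop_iterate n) (hv.aop_iterate n)]

theorem aop_iterate_const_smul (n : ℕ) (c : ℝ) (hu : SmoothPeriodic u) :
    Aop^[n] (c • u) = c • Aop^[n] u := by
  induction n with
  | zero => rfl
  | succ n ih => simp only [Function.iterate_succ_apply', ih, aop_const_smul c (hu.aop_iterate n)]

theorem pdx_aop (hu : SmoothPeriodic u) : pdx (Aop u) = Aop (pdx u) := by
  change pdx (-(pdx (pdx u) + pdy (pdy u)) + u) = -(pdx (pdx (pdx u)) + pdy (pdy (pdx u))) + pdx u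
  rw [pdx_add (hu.pdx.pdx.add hu.pdy.pdy).neg hu, pdx_neg, pdx_add hu.pdx.pdx hu.pdy.pdy,
    pdx_pdy_comm hu.pdy, pdx_pdy_comm hu]

theorem pdy_aop (hu : SmoothPeriodic u) : pdy (Aop u) = Aop (pdy u) := by
  change pdy (-(pdx (pdx u) + pdy (pdy u)) + u) = -(pdx (pdx (pdy u)) + pdy (pdy (pdy u))) + pdy u
  rw [pdy_add (hu.pdx.pdx.add hu.pdy.pdy).neg hu, pdy_neg, pdy_add hu.pdx.pdx hu.pdy.pdy,
    ← pdx_pdy_comm hu.pdx, ← pdx_pdy_comm hu]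

end Derivatives

section Integrals

variable {u v w : ℝ × ℝ → ℝ}

theorem measurableSet_sq2 : MeasurableSet sq2 := measurableSet_Icc.prod measurableSet_Icc

theorem integrableOn_sq2 (hu : Continuous u) : IntegrableOn u sq2 :=
  hu.continuousOn.integrableOn_compact (isCompact_Icc.prod isCompact_Icc)

theorem integral_sq2_eq (hu : Continuous u) :
    ∫ p in sq2, u p =
      ∫ x in Set.Icc (0 : ℝ) (2 * π), ∫ y in Set.Icc (0 : ℝ) (2 * π), u (x, y) :=
  setIntegral_prod u (integrableOn_sq2 hu)

theorem integral_sq2_eq_symm (hu : Continuous u) :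
    ∫ p in sq2, u p =
      ∫ y in Set.Icc (0 : ℝ) (2 * π), ∫ x in Set.Icc (0 : ℝ) (2 * π), u (x, y) := by
  have h : ∫ p in sq2, u p = ∫ p in sq2, u p.swap :=
    (setIntegral_prod_swap (μ := volume) (ν := volume) (Set.Icc (0 : ℝ) (2 * π))
      (Set.Icc (0 : ℝ) (2 * π)) u).symm
  exact h.trans (integral_sq2_eq (hu.comp continuous_swap))

theorem hasDerivAt_fst (hu : SmoothPeriodic u) (x y : ℝ) :
    HasDerivAt (fun t => u (t, y)) (pdx u (x, y)) x :=
  (hu.differentiable (x, y)).hasFDerivAt.comp_hasDerivAt x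
    ((hasDerivAt_id x).prodMk (hasDerivAt_const x y))

theorem hasDerivAt_snd (hu : SmoothPeriodic u) (x y : ℝ) :
    HasDerivAt (fun t => u (x, t)) (pdy u (x, y)) y :=
  (hu.differentiable (x, y)).hasFDerivAt.comp_hasDerivAt y
    ((hasDerivAt_const y x).prodMk (hasDerivAt_id y))

theorem integral_pdx_eq_zero (hu : SmoothPeriodic u) : ∫ p in sq2, pdx u p = 0 := by
  rw [integral_sq2_eq_symm hu.pdx.continuous]
  refine integral_eq_zero_of_ae (Eventually.of_forall fun y => ?_)
  have hc : Continuous fun x => pdx u (x, y) := hu.pdx.continuous.comp (by fun_prop)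
  have h := intervalIntegral.integral_eq_sub_of_hasDerivAt (a := 0) (b := 2 * π)
    (fun x _ => hasDerivAt_fst hu x y) (hc.intervalIntegrable _ _)
  have hp := hu.2.1 0 y
  rw [zero_add] at hp
  rw [intervalIntegral.integral_of_le (by positivity), hp, sub_self] at h
  simpa [integral_Icc_eq_integral_Ioc] using h

theorem integral_pdy_eq_zero (hu : SmoothPeriodic u) : ∫ p in sq2, pdy u p = 0 := by
  rw [integral_sq2_eq hu.pdy.continuous]
  refine integral_eq_zero_of_ae (Eventually.of_forall fun x => ?_)
  have hc : Continuous fun y => pdy u (x, y) := hu.pdy.continuous.comp (by fun_prop)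
  have h := intervalIntegral.integral_eq_sub_of_hasDerivAt (a := 0) (b := 2 * π)
    (fun y _ => hasDerivAt_snd hu x y) (hc.intervalIntegrable _ _)
  have hp := hu.2.2 x 0
  rw [zero_add] at hp
  rw [intervalIntegral.integral_of_le (by positivity), hp, sub_self] at h
  simpa [integral_Icc_eq_integral_Ioc] using h

theorem l2inner_comm (u v : ℝ × ℝ → ℝ) : l2inner u v = l2inner v u := by
  simp only [l2inner, mul_comm]

theorem l2inner_add_right (hu : Continuous u) (hv : Continuous v) (hw : Continuous w) :
    l2inner u (v + w) = l2inner u v + l2inner u w := by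
  simp only [l2inner, Pi.add_apply, mul_add]
  exact integral_add (integrableOn_sq2 (hu.mul hv)) (integrableOn_sq2 (hu.mul hw))

theorem l2inner_add_left (hu : Continuous u) (hv : Continuous v) (hw : Continuous w) :
    l2inner (u + v) w = l2inner u w + l2inner v w := by
  rw [l2inner_comm, l2inner_add_right hw hu hv, l2inner_comm w u, l2inner_comm w v]

theorem l2inner_const_smul_right (c : ℝ) (u v : ℝ × ℝ → ℝ) :
    l2inner u (c • v) = c * l2inner u v := by
  simp only [l2inner, Pi.smul_apply, smul_eq_mul, mul_left_comm _ c]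
  exact integral_const_mul _ _

theorem l2inner_neg_right (u v : ℝ × ℝ → ℝ) : l2inner u (-v) = -l2inner u v := by
  simpa using l2inner_const_smul_right (-1) u v

theorem l2inner_pdx (hu : SmoothPeriodic u) (hv : SmoothPeriodic v) :
    l2inner (pdx u) v = -l2inner u (pdx v) := by
  have h := integral_pdx_eq_zero (hu.mul hv)
  rw [pdx_mul hu hv] at h
  have h' := integral_add (integrableOn_sq2 (hu.pdx.mul hv).continuous)
    (integrableOn_sq2 (hu.mul hv.pdx).continuous)
  simp only [Pi.add_apply, Pi.mul_apply] at h h'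
  simp only [l2inner]
  linarith

theorem l2inner_pdy (hu : SmoothPeriodic u) (hv : SmoothPeriodic v) :
    l2inner (pdy u) v = -l2inner u (pdy v) := by
  have h := integral_pdy_eq_zero (hu.mul hv)
  rw [pdy_mul hu hv] at h
  have h' := integral_add (integrableOn_sq2 (hu.pdy.mul hv).continuous)
    (integrableOn_sq2 (hu.mul hv.pdy).continuous)
  simp only [Pi.add_apply, Pi.mul_apply] at h h'
  simp only [l2inner]
  linarith

theorem l2inner_aop_right (hu : SmoothPeriodic u) (hv : SmoothPeriodic v) :
    l2inner u (Aop v) = l2inner u v + l2inner (pdx u) (pdx v) + l2inner (pdy u) (pdy v) := by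
  change l2inner u (-(pdx (pdx v) + pdy (pdy v)) + v) = _
  rw [l2inner_add_right hu.continuous (hv.pdx.pdx.add hv.pdy.pdy).neg.continuous hv.continuous,
    l2inner_neg_right, l2inner_add_right hu.continuous hv.pdx.pdx.continuous
    hv.pdy.pdy.continuous, l2inner_pdx hu hv.pdx, l2inner_pdy hu hv.pdy]
  ring

theorem l2inner_aop_comm (hu : SmoothPeriodic u) (hv : SmoothPeriodic v) :
    l2inner (Aop u) v = l2inner u (Aop v) := by
  rw [l2inner_comm, l2inner_aop_right hv hu, l2inner_aop_right hu hv, l2inner_comm v,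
    l2inner_comm (pdx v), l2inner_comm (pdy v)]

theorem l2norm_nonneg (u : ℝ × ℝ → ℝ) : 0 ≤ l2norm u := Real.sqrt_nonneg _

theorem l2norm_sq (u : ℝ × ℝ → ℝ) : l2norm u ^ 2 = l2inner u u := by
  rw [l2norm, Real.sq_sqrt (integral_nonneg fun _ => sq_nonneg _)]
  simp only [l2inner, sq]

theorem l2inner_self_nonneg (u : ℝ × ℝ → ℝ) : 0 ≤ l2inner u u :=
  integral_nonneg fun _ => mul_self_nonneg _

theorem l2inner_le (hu : Continuous u) (hv : Continuous v) :
    l2inner u v ≤ l2norm u * l2norm v := by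
  have h : ∀ t : ℝ, 0 ≤ l2inner v v * (t * t) + 2 * l2inner u v * t + l2inner u u := by
    intro t
    have h0 := l2inner_self_nonneg (u + t • v)
    have hc : Continuous (t • v) := hv.const_smul t
    rw [l2inner_add_right (hu.add hc) hu hc, l2inner_add_left hu hc hu,
      l2inner_const_smul_right, l2inner_add_left hu hc hv, l2inner_comm (t • v) u,
      l2inner_comm (t • v) v, l2inner_const_smul_right, l2inner_const_smul_right] at h0
    linarith
  have hd := discrim_le_zero h
  rw [discrim, ← l2norm_sq, ← l2norm_sq] at hd
  refine abs_le_of_sq_le_sq' ?_ (mul_nonneg (l2norm_nonneg u) (l2norm_nonneg v)) |>.2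
  linarith

theorem abs_l2inner_le (hu : Continuous u) (hv : Continuous v) :
    |l2inner u v| ≤ l2norm u * l2norm v := by
  refine abs_le'.2 ⟨l2inner_le hu hv, ?_⟩
  have h := l2inner_le hu hv.neg
  rw [l2inner_neg_right] at h
  simpa [l2norm] using h

theorem integral_abs_mul_le (hu : Continuous u) (hv : Continuous v) :
    ∫ p in sq2, |u p * v p| ≤ l2norm u * l2norm v := by
  have h := l2inner_le hu.abs hv.abs
  simpa only [l2inner, l2norm, sq_abs, abs_mul] using h

theorem l2norm_add_le (hu : Continuous u) (hv : Continuous v) :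
    l2norm (u + v) ≤ l2norm u + l2norm v := by
  refine abs_le_of_sq_le_sq' ?_ (add_nonneg (l2norm_nonneg u) (l2norm_nonneg v)) |>.2
  rw [l2norm_sq, l2inner_add_right (hu.add hv) hu hv, l2inner_add_left hu hv hu,
    l2inner_add_left hu hv hv, l2inner_comm v u]
  nlinarith [l2inner_le hu hv, l2norm_sq u, l2norm_sq v]

theorem l2norm_neg (u : ℝ × ℝ → ℝ) : l2norm (-u) = l2norm u := by
  simp [l2norm]

theorem l2norm_mul_le {B C : ℝ} (hu : Continuous u) (hv : Continuous v)
    (hB : ∀ p ∈ sq2, |u p| ≤ B) (hC : l2norm v ≤ C) : l2norm (u * v) ≤ B * C := by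
  have hB0 : 0 ≤ B := (abs_nonneg _).trans
    (hB (0, 0) ⟨⟨le_rfl, by positivity⟩, ⟨le_rfl, by positivity⟩⟩)
  refine le_trans ?_ (mul_le_mul_of_nonneg_left hC hB0)
  refine abs_le_of_sq_le_sq' ?_ (mul_nonneg hB0 (l2norm_nonneg v)) |>.2
  rw [mul_pow, l2norm_sq, l2norm_sq, ← l2inner_const_smul_right]
  refine setIntegral_mono_on (integrableOn_sq2 ((hu.mul hv).mul (hu.mul hv)))
    (integrableOn_sq2 (hv.mul (hv.const_smul _))) measurableSet_sq2 fun p hp => ?_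
  have h := sq_le_sq' (abs_le.1 (hB p hp)).1 (abs_le.1 (hB p hp)).2
  simp only [Pi.mul_apply, Pi.smul_apply, smul_eq_mul]
  nlinarith [mul_le_mul_of_nonneg_right h (sq_nonneg (v p))]

end Integrals

section Agmon

theorem abs_le_setIntegral_Icc {g g' : ℝ → ℝ} (hg : ∀ x, HasDerivAt g (g' x) x)
    (hg' : Continuous g') {x₀ : ℝ} (hx₀ : x₀ ∈ Set.Icc (0 : ℝ) (2 * π)) :
    |g x₀| ≤ ∫ x in Set.Icc (0 : ℝ) (2 * π), (|g x| + |g' x|) := by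
  have hc : Continuous g := continuous_iff_continuousAt.2 fun x => (hg x).continuousAt
  have hi : ∀ {h : ℝ → ℝ}, Continuous h → IntegrableOn h (Set.Icc (0 : ℝ) (2 * π)) :=
    fun hh => hh.continuousOn.integrableOn_compact isCompact_Icc
  set J := ∫ x in Set.Icc (0 : ℝ) (2 * π), |g' x| with hJ
  have hpt : ∀ x ∈ Set.Icc (0 : ℝ) (2 * π), |g x₀| - J ≤ |g x| := by
    intro x hx
    have h1 : ∫ t in x..x₀, g' t = g x₀ - g x :=
      intervalIntegral.integral_eq_sub_of_hasDerivAt (fun t _ => hg t)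
        (hg'.intervalIntegrable _ _)
    have h2 := intervalIntegral.norm_integral_le_integral_norm_uIoc (f := g') (a := x) (b := x₀)
      (μ := volume)
    have h3 : ∫ t in Set.uIoc x x₀, ‖g' t‖ ≤ J :=
      setIntegral_mono_set (hi hg'.abs) (Eventually.of_forall fun _ => abs_nonneg _)
        ((Set.uIoc_subset_uIcc.trans (Set.uIcc_subset_Icc hx hx₀)).eventuallyLE)
    rw [h1, Real.norm_eq_abs] at h2
    linarith [abs_sub_abs_le_abs_sub (g x₀) (g x)]
  have hint := setIntegral_mono_on (hi (continuous_const (y := |g x₀| - J))) (hi hc.abs)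
    measurableSet_Icc hpt
  rw [setIntegral_const, Real.volume_real_Icc_of_le (by positivity), smul_eq_mul] at hint
  rw [integral_add (hi hc.abs) (hi hg'.abs), ← hJ]
  have h0 : 0 ≤ ∫ x in Set.Icc (0 : ℝ) (2 * π), |g x| := integral_nonneg fun _ => abs_nonneg _
  by_contra! hlt
  nlinarith [Real.pi_gt_three]

variable {u v : ℝ × ℝ → ℝ}

theorem abs_le_integral_sq2 (hu : SmoothPeriodic u) {p : ℝ × ℝ} (hp : p ∈ sq2) :
    |u p| ≤ ∫ q in sq2, (|u q| + |pdy u q| + (|pdx u q| + |pdy (pdx u) q|)) := by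
  obtain ⟨x₀, y₀⟩ := p
  have hcu := hu.continuous
  have hcx := hu.pdx.continuous
  have hcy := hu.pdy.continuous
  have hcxy := hu.pdx.pdy.continuous
  have hc : Continuous fun q => |u q| + |pdy u q| + (|pdx u q| + |pdy (pdx u) q|) := by fun_prop
  have hi : ∀ {h : ℝ → ℝ}, Continuous h → IntegrableOn h (Set.Icc (0 : ℝ) (2 * π)) :=
    fun hh => hh.continuousOn.integrableOn_compact isCompact_Icc
  refine (abs_le_setIntegral_Icc (fun x => hasDerivAt_fst hu x y₀)
    (hcx.comp (by fun_prop)) hp.1).trans ?_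
  rw [integral_sq2_eq hc]
  have hprod : Integrable (fun q => |u q| + |pdy u q| + (|pdx u q| + |pdy (pdx u) q|))
      ((volume.restrict (Set.Icc (0 : ℝ) (2 * π))).prod
        (volume.restrict (Set.Icc (0 : ℝ) (2 * π)))) := by
    rw [Measure.prod_restrict]
    exact integrableOn_sq2 hc
  refine setIntegral_mono_on (hi (by fun_prop)) hprod.integral_prod_left measurableSet_Icc
    fun x _ => ?_
  rw [integral_add (hi (by fun_prop)) (hi (by fun_prop))]
  exact add_le_add
    (abs_le_setIntegral_Icc (fun y => hasDerivAt_snd hu x y) (hcy.comp (by fun_prop)) hp.2)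
    (abs_le_setIntegral_Icc (fun y => hasDerivAt_snd hu.pdx x y) (hcxy.comp (by fun_prop)) hp.2)

theorem sq_le_l2norm_derivatives (hu : SmoothPeriodic u) {p : ℝ × ℝ} (hp : p ∈ sq2) :
    u p ^ 2 ≤ l2norm u * l2norm u + 2 * (l2norm u * l2norm (pdx u)) +
      2 * (l2norm u * l2norm (pdy u)) + 2 * (l2norm (pdy u) * l2norm (pdx u)) +
      2 * (l2norm u * l2norm (pdy (pdx u))) := by
  have hcu := hu.continuous
  have hcx := hu.pdx.continuous
  have hcy := hu.pdy.continuous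
  have hcxy := hu.pdx.pdy.continuous
  have h := abs_le_integral_sq2 (hu.mul hu) hp
  have hx : pdx (u * u) = (2 : ℝ) • (u * pdx u) := by
    rw [pdx_mul hu hu, mul_comm, two_smul]
  have hy : pdy (u * u) = (2 : ℝ) • (u * pdy u) := by
    rw [pdy_mul hu hu, mul_comm, two_smul]
  rw [hx, hy, pdy_const_smul _ (hu.mul hu.pdx), pdy_mul hu hu.pdx] at h
  have hle : ∀ q, |(u * u) q| + |((2 : ℝ) • (u * pdy u)) q| + (|((2 : ℝ) • (u * pdx u)) q| +
      |((2 : ℝ) • (pdy u * pdx u + u * pdy (pdx u))) q|) ≤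
      |u q * u q| + 2 * |u q * pdx u q| + 2 * |u q * pdy u q| + 2 * |pdy u q * pdx u q| +
        2 * |u q * pdy (pdx u) q| := by
    intro q
    simp only [Pi.smul_apply, Pi.mul_apply, Pi.add_apply, smul_eq_mul, abs_mul (2 : ℝ), abs_two]
    linarith [abs_add_le (pdy u q * pdx u q) (u q * pdy (pdx u) q)]
  have hint : ∀ {h : ℝ × ℝ → ℝ}, Continuous h → Integrable h (volume.restrict sq2) :=
    fun hh => integrableOn_sq2 hh
  have h2 := h.trans (integral_mono (hint (by
    simp only [Pi.smul_apply, Pi.mul_apply, Pi.add_apply]; fun_prop)) (hint (by fun_prop)) hle)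
  rw [integral_add (hint (by fun_prop)) (hint (by fun_prop)),
    integral_add (hint (by fun_prop)) (hint (by fun_prop)),
    integral_add (hint (by fun_prop)) (hint (by fun_prop)),
    integral_add (hint (by fun_prop)) (hint (by fun_prop)), integral_const_mul,
    integral_const_mul, integral_const_mul, integral_const_mul] at h2
  have h3 : u p ^ 2 = |(u * u) p| := by rw [Pi.mul_apply, abs_mul_self, sq]
  linarith [integral_abs_mul_le hcu hcu, integral_abs_mul_le hcu hcx,
    integral_abs_mul_le hcu hcy, integral_abs_mul_le hcy hcx, integral_abs_mul_le hcu hcxy]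

end Agmon

/-- The energy `(u, A^k u)`, expressed as a weighted sum of squared `L²` norms of the
derivatives of `u` of order at most `k`. -/
def sobEnergy : ℕ → (ℝ × ℝ → ℝ) → ℝ
  | 0, u => l2norm u ^ 2
  | k + 1, u => sobEnergy k u + sobEnergy k (pdx u) + sobEnergy k (pdy u)

section Energy

variable {u : ℝ × ℝ → ℝ}

theorem sobEnergy_nonneg (k : ℕ) (u : ℝ × ℝ → ℝ) : 0 ≤ sobEnergy k u := by
  induction k generalizing u with
  | zero => exact sq_nonneg _
  | succ k ih => exact add_nonneg (add_nonneg (ih _) (ih _)) (ih _)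

theorem sobEnergy_le_succ (k : ℕ) (u : ℝ × ℝ → ℝ) : sobEnergy k u ≤ sobEnergy (k + 1) u := by
  rw [sobEnergy]
  linarith [sobEnergy_nonneg k (pdx u), sobEnergy_nonneg k (pdy u)]

theorem sobEnergy_pdx_le (k : ℕ) (u : ℝ × ℝ → ℝ) :
    sobEnergy k (pdx u) ≤ sobEnergy (k + 1) u := by
  rw [sobEnergy]
  linarith [sobEnergy_nonneg k u, sobEnergy_nonneg k (pdy u)]

theorem sobEnergy_pdy_le (k : ℕ) (u : ℝ × ℝ → ℝ) :
    sobEnergy k (pdy u) ≤ sobEnergy (k + 1) u := by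
  rw [sobEnergy]
  linarith [sobEnergy_nonneg k u, sobEnergy_nonneg k (pdx u)]

theorem sobEnergy_one (hu : SmoothPeriodic u) : sobEnergy 1 u = l2inner u (Aop u) := by
  simp only [sobEnergy, l2norm_sq, l2inner_aop_right hu hu]

theorem sobEnergy_add_two (k : ℕ) (hu : SmoothPeriodic u) :
    sobEnergy (k + 2) u = sobEnergy k (Aop u) := by
  induction k generalizing u with
  | zero =>
    change sobEnergy 1 u + sobEnergy 1 (pdx u) + sobEnergy 1 (pdy u) = sobEnergy 0 (Aop u)
    rw [sobEnergy_one hu, sobEnergy_one hu.pdx, sobEnergy_one hu.pdy, sobEnergy,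
      l2norm_sq, l2inner_aop_right hu.aop hu, ← pdx_aop hu, ← pdy_aop hu, l2inner_comm u,
      l2inner_comm (pdx u), l2inner_comm (pdy u)]
  | succ k ih =>
    rw [sobEnergy, ih hu, ih hu.pdx, ih hu.pdy, sobEnergy, pdx_aop hu, pdy_aop hu]

theorem sobEnergy_two_mul (n : ℕ) (hu : SmoothPeriodic u) :
    sobEnergy (2 * n) u = l2norm (Aop^[n] u) ^ 2 := by
  induction n generalizing u with
  | zero => rfl
  | succ n ih => rw [mul_add, mul_one, sobEnergy_add_two _ hu, ih hu.aop]; rfl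

theorem add_sq_le_mul {a b c a' b' c' : ℝ} (hb : 0 ≤ b) (hc : 0 ≤ c)
    (hb' : 0 ≤ b') (hc' : 0 ≤ c') (h : a ^ 2 ≤ b * c) (h' : a' ^ 2 ≤ b' * c') :
    (a + a') ^ 2 ≤ (b + b') * (c + c') := by
  have h1 : a * a' ≤ (b * c' + b' * c) / 2 := by
    refine abs_le_of_sq_le_sq' ?_ (by positivity) |>.2
    have := mul_le_mul h h' (sq_nonneg a') (by positivity)
    nlinarith [sq_nonneg (b * c' - b' * c)]
  nlinarith

theorem sobEnergy_sq_le (k : ℕ) (hu : SmoothPeriodic u) :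
    sobEnergy (k + 1) u ^ 2 ≤ sobEnergy k u * sobEnergy (k + 2) u := by
  induction k generalizing u with
  | zero =>
    rw [sobEnergy_add_two 0 hu, zero_add, sobEnergy_one hu, sobEnergy, sobEnergy, ← mul_pow]
    exact sq_le_sq.2 ((abs_l2inner_le hu.continuous hu.aop.continuous).trans (le_abs_self _))
  | succ k ih =>
    have hn := sobEnergy_nonneg
    rw [sobEnergy, sobEnergy.eq_2 u k, sobEnergy.eq_2 u (k + 2)]
    exact add_sq_le_mul (add_nonneg (hn _ _) (hn _ _)) (add_nonneg (hn _ _) (hn _ _)) (hn _ _)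
      (hn _ _) (add_sq_le_mul (hn _ _) (hn _ _) (hn _ _) (hn _ _) (ih hu) (ih hu.pdx))
      (ih hu.pdy)

theorem agmon (hu : SmoothPeriodic u) {p : ℝ × ℝ} (hp : p ∈ sq2) :
    u p ^ 2 ≤ 9 * (l2norm u * l2norm (Aop u)) := by
  have hu0 := l2norm_nonneg u
  have h2 : sobEnergy 2 u = l2norm (Aop u) ^ 2 := sobEnergy_add_two 0 hu
  have h1 : sobEnergy 1 u ≤ l2norm u * l2norm (Aop u) :=
    sobEnergy_one hu ▸ l2inner_le hu.continuous hu.aop.continuous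
  have h12 := sobEnergy_le_succ 1 u
  have h01 := sobEnergy_le_succ 0 u
  have hx := sobEnergy_pdx_le 0 u
  have hy := sobEnergy_pdy_le 0 u
  have hxy := (sobEnergy_pdy_le 0 (pdx u)).trans (sobEnergy_pdx_le 1 u)
  simp only [zero_add, Nat.reduceAdd, h2, sobEnergy.eq_1] at h12 h01 hx hy hxy
  have hle : ∀ {t : ℝ}, t ^ 2 ≤ l2norm (Aop u) ^ 2 → l2norm u * t ≤ l2norm u * l2norm (Aop u) :=
    fun h => mul_le_mul_of_nonneg_left (abs_le_of_sq_le_sq' h (l2norm_nonneg _)).2 hu0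
  have hmul : l2norm (pdy u) * l2norm (pdx u) ≤ sobEnergy 1 u := by
    nlinarith [sq_nonneg (l2norm (pdy u) - l2norm (pdx u))]
  linarith [sq_le_l2norm_derivatives hu hp, hle (h01.trans h12), hle (hx.trans h12),
    hle (hy.trans h12), hle hxy]

/-- A log-convex sequence lying below a geometric one at `0` and at `s` lies below it in between. -/
theorem le_of_logConvex {q : ℕ → ℝ} {s : ℕ} {B r : ℝ} (hB : 0 < B) (hr : 0 < r)
    (hq : ∀ k, 0 ≤ q k) (hlog : ∀ k, q (k + 1) ^ 2 ≤ q k * q (k + 2)) (h0 : q 0 ≤ B)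
    (hs : q s ≤ B * r ^ s) {k : ℕ} (hk : k ≤ s) : q k ≤ B * r ^ k := by
  set t : ℕ → ℝ := fun k => q k / (B * r ^ k) with ht
  have htn : ∀ k, 0 ≤ t k := fun k => div_nonneg (hq k) (by positivity)
  have htl : ∀ k, t (k + 1) ^ 2 ≤ t k * t (k + 2) := by
    intro k
    simp only [ht]
    rw [div_pow, div_mul_div_comm, show B * r ^ k * (B * r ^ (k + 2)) = (B * r ^ (k + 1)) ^ 2 by
      ring]
    exact div_le_div_of_nonneg_right (hlog k) (by positivity)
  have hiff : ∀ k, t k ≤ 1 ↔ q k ≤ B * r ^ k := fun k => div_le_one (by positivity)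
  have ht0 : t 0 ≤ 1 := (hiff 0).2 (by simpa using h0)
  have hpow : ∀ k, t k ^ (k + 1) ≤ t (k + 1) ^ k := by
    intro k
    induction k with
    | zero => simpa using ht0
    | succ k ih =>
      rcases (htn (k + 1)).eq_or_lt with h | h
      · rw [← h, zero_pow (by omega)]
        exact pow_nonneg (htn _) _
      · have h1 : (t (k + 1) ^ 2) ^ (k + 1) ≤ (t k * t (k + 2)) ^ (k + 1) :=
          pow_le_pow_left₀ (sq_nonneg _) (htl k) _
        rw [mul_pow] at h1
        have h2 := h1.trans (mul_le_mul_of_nonneg_right ih (pow_nonneg (htn (k + 2)) _))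
        refine le_of_mul_le_mul_left ?_ (pow_pos h k)
        calc t (k + 1) ^ k * t (k + 1) ^ (k + 1 + 1) = (t (k + 1) ^ 2) ^ (k + 1) := by ring
          _ ≤ _ := h2
  rw [← hiff]
  induction hk using Nat.decreasingInduction with
  | self => exact (hiff s).2 hs
  | of_succ k _ ih =>
    exact (pow_le_one_iff_of_nonneg (htn k) (by omega)).1
      ((hpow k).trans (pow_le_one₀ (htn _) ih))

end Energy

/-- `P B v` bounds a seminorm of `v` by `B`, on the space of smooth periodic functions. -/
structure IsSeminormBound (P : ℝ → (ℝ × ℝ → ℝ) → Prop) : Prop where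
  nonneg : ∀ {B u}, P B u → 0 ≤ B
  mono : ∀ {B C u}, P B u → B ≤ C → P C u
  neg : ∀ {B u}, P B u → P B (-u)
  add : ∀ {B C u v}, SmoothPeriodic u → SmoothPeriodic v → P B u → P C v → P (B + C) (u + v)

/-- The function is bounded by `B` on the fundamental domain. -/
def SupBound (B : ℝ) (u : ℝ × ℝ → ℝ) : Prop := ∀ p ∈ sq2, |u p| ≤ B

/-- The `L²` norm is bounded by `B`. -/
def L2Bound (B : ℝ) (u : ℝ × ℝ → ℝ) : Prop := l2norm u ≤ B

/-- Every derivative of `u` of order `k ≤ n` satisfies the bound `P` with constant `B * ρ ^ k`. -/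
def DerivBound (P : ℝ → (ℝ × ℝ → ℝ) → Prop) (ρ : ℝ) : ℕ → ℝ → (ℝ × ℝ → ℝ) → Prop
  | 0, B, u => P B u
  | n + 1, B, u => P B u ∧ DerivBound P ρ n (B * ρ) (pdx u) ∧ DerivBound P ρ n (B * ρ) (pdy u)

theorem isSeminormBound_supBound : IsSeminormBound SupBound where
  nonneg h := (abs_nonneg _).trans
    (h (0, 0) ⟨⟨le_rfl, by positivity⟩, ⟨le_rfl, by positivity⟩⟩)
  mono h hBC p hp := (h p hp).trans hBC
  neg h p hp := by simpa using h p hp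
  add _ _ h h' p hp := (abs_add_le _ _).trans (add_le_add (h p hp) (h' p hp))

theorem isSeminormBound_l2Bound : IsSeminormBound L2Bound where
  nonneg h := (l2norm_nonneg _).trans h
  mono h hBC := h.trans hBC
  neg h := (l2norm_neg _).trans_le h
  add hu hv h h' := (l2norm_add_le hu.continuous hv.continuous).trans (add_le_add h h')

namespace DerivBound

variable {P P₁ P₂ : ℝ → (ℝ × ℝ → ℝ) → Prop} {ρ B C : ℝ} {n : ℕ} {u v : ℝ × ℝ → ℝ}

theorem bound (h : DerivBound P ρ n B u) : P B u := by
  cases n with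
  | zero => exact h
  | succ n => exact h.1

theorem of_succ (h : DerivBound P ρ (n + 1) B u) : DerivBound P ρ n B u := by
  induction n generalizing B u with
  | zero => exact h.1
  | succ n ih => exact ⟨h.1, ih h.2.1, ih h.2.2⟩

theorem mono (hP : IsSeminormBound P) (hρ : 0 ≤ ρ) (h : DerivBound P ρ n B u) (hBC : B ≤ C) :
    DerivBound P ρ n C u := by
  induction n generalizing B C u with
  | zero => exact hP.mono h hBC
  | succ n ih =>
    have := mul_le_mul_of_nonneg_right hBC hρ
    exact ⟨hP.mono h.1 hBC, ih h.2.1 this, ih h.2.2 this⟩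

theorem neg (hP : IsSeminormBound P) (h : DerivBound P ρ n B u) : DerivBound P ρ n B (-u) := by
  induction n generalizing B u with
  | zero => exact hP.neg h
  | succ n ih => exact ⟨hP.neg h.1, pdx_neg u ▸ ih h.2.1, pdy_neg u ▸ ih h.2.2⟩

theorem add (hP : IsSeminormBound P) (hu : SmoothPeriodic u) (hv : SmoothPeriodic v)
    (h : DerivBound P ρ n B u) (h' : DerivBound P ρ n C v) :
    DerivBound P ρ n (B + C) (u + v) := by
  induction n generalizing B C u v with
  | zero => exact hP.add hu hv h h'
  | succ n ih =>
    refine ⟨hP.add hu hv h.1 h'.1, ?_, ?_⟩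
    · rw [pdx_add hu hv, add_mul]
      exact ih hu.pdx hv.pdx h.2.1 h'.2.1
    · rw [pdy_add hu hv, add_mul]
      exact ih hu.pdy hv.pdy h.2.2 h'.2.2

theorem mul (hP₁ : IsSeminormBound P₁) (hP₂ : IsSeminormBound P₂) (hP : IsSeminormBound P)
    (hmul : ∀ {B C u v}, SmoothPeriodic u → SmoothPeriodic v → P₁ B u → P₂ C v →
      P (B * C) (u * v))
    (hu : SmoothPeriodic u) (hv : SmoothPeriodic v)
    (h : DerivBound P₁ ρ n B u) (h' : DerivBound P₂ ρ n C v) :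
    DerivBound P ρ n (2 ^ n * (B * C)) (u * v) := by
  induction n generalizing B C u v with
  | zero =>
    rw [pow_zero, one_mul]
    exact hmul hu hv h h'
  | succ n ih =>
    have hBC : 0 ≤ B * C := mul_nonneg (hP₁.nonneg h.1) (hP₂.nonneg h'.1)
    have hc : 2 ^ (n + 1) * (B * C) * ρ = 2 ^ n * (B * ρ * C) + 2 ^ n * (B * (C * ρ)) := by ring
    refine ⟨hP.mono (hmul hu hv h.1 h'.1) (le_mul_of_one_le_left hBC (one_le_pow₀ one_le_two)),
      ?_, ?_⟩
    · rw [pdx_mul hu hv, hc]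
      exact add hP (hu.pdx.mul hv) (hu.mul hv.pdx) (ih hu.pdx hv h.2.1 h'.of_succ)
        (ih hu hv.pdx h.of_succ h'.2.1)
    · rw [pdy_mul hu hv, hc]
      exact add hP (hu.pdy.mul hv) (hu.mul hv.pdy) (ih hu.pdy hv h.2.2 h'.of_succ)
        (ih hu hv.pdy h.of_succ h'.2.2)

theorem mul_sup (hu : SmoothPeriodic u) (hv : SmoothPeriodic v)
    (h : DerivBound SupBound ρ n B u) (h' : DerivBound SupBound ρ n C v) :
    DerivBound SupBound ρ n (2 ^ n * (B * C)) (u * v) := by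
  refine mul isSeminormBound_supBound isSeminormBound_supBound isSeminormBound_supBound
    (fun _ _ h h' p hp => ?_) hu hv h h'
  rw [Pi.mul_apply, abs_mul]
  exact mul_le_mul (h p hp) (h' p hp) (abs_nonneg _) ((abs_nonneg _).trans (h p hp))

theorem mul_l2 (hu : SmoothPeriodic u) (hv : SmoothPeriodic v)
    (h : DerivBound SupBound ρ n B u) (h' : DerivBound L2Bound ρ n C v) :
    DerivBound L2Bound ρ n (2 ^ n * (B * C)) (u * v) :=
  mul isSeminormBound_supBound isSeminormBound_l2Bound isSeminormBound_l2Bound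
    (fun hu hv h h' => l2norm_mul_le hu.continuous hv.continuous h h') hu hv h h'

theorem aop (hP : IsSeminormBound P) (hρ : 1 ≤ ρ) (hu : SmoothPeriodic u)
    (h : DerivBound P ρ (n + 2) B u) : DerivBound P ρ n (3 * ρ ^ 2 * B) (Aop u) := by
  have hB := hP.nonneg h.bound
  have h1 := add hP hu.pdx.pdx hu.pdy.pdy h.2.1.2.1 h.2.2.2.2
  refine (add hP (hu.pdx.pdx.add hu.pdy.pdy).neg hu (h1.neg hP) h.of_succ.of_succ).mono hP
    (by positivity) ?_
  nlinarith [mul_le_mul_of_nonneg_left (one_le_pow₀ (n := 2) hρ) hB]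

theorem aop_iterate (hP : IsSeminormBound P) (hρ : 1 ≤ ρ) (hu : SmoothPeriodic u) (k : ℕ)
    (h : DerivBound P ρ (2 * k) B u) : P ((3 * ρ ^ 2) ^ k * B) (Aop^[k] u) := by
  induction k generalizing B u with
  | zero => simpa using h.bound
  | succ k ih =>
    have := ih hu.aop (aop hP hρ hu h)
    rwa [← mul_assoc, ← pow_succ] at this

theorem of_sobEnergy_le {c : ℝ}
    (hP : ∀ {B u}, 0 ≤ B → SmoothPeriodic u →
      (∀ k ≤ 2, sobEnergy k u ≤ (B * ρ ^ k) ^ 2) → P (c * B) u)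
    (hB : 0 ≤ B) (hρ : 0 ≤ ρ) (hu : SmoothPeriodic u)
    (h : ∀ k ≤ n + 2, sobEnergy k u ≤ (B * ρ ^ k) ^ 2) : DerivBound P ρ n (c * B) u := by
  have hbase : P (c * B) u := hP hB hu fun k hk => h k (by omega)
  induction n generalizing B u with
  | zero => exact hbase
  | succ n ih =>
    have hx : ∀ k ≤ n + 2, sobEnergy k (pdx u) ≤ (B * ρ * ρ ^ k) ^ 2 := fun k hk =>
      (sobEnergy_pdx_le k u).trans ((h (k + 1) (by omega)).trans_eq (by ring))
    have hy : ∀ k ≤ n + 2, sobEnergy k (pdy u) ≤ (B * ρ * ρ ^ k) ^ 2 := fun k hk =>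
      (sobEnergy_pdy_le k u).trans ((h (k + 1) (by omega)).trans_eq (by ring))
    have hBρ : 0 ≤ B * ρ := mul_nonneg hB hρ
    refine ⟨hbase, ?_, ?_⟩ <;> rw [mul_assoc]
    · exact ih hBρ hu.pdx hx (hP hBρ hu.pdx fun k hk => hx k (by omega))
    · exact ih hBρ hu.pdy hy (hP hBρ hu.pdy fun k hk => hy k (by omega))

theorem l2_of_sobEnergy_le (hB : 0 ≤ B) (hρ : 0 ≤ ρ) (hu : SmoothPeriodic u)
    (h : ∀ k ≤ n + 2, sobEnergy k u ≤ (B * ρ ^ k) ^ 2) : DerivBound L2Bound ρ n B u := by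
  have := of_sobEnergy_le (P := L2Bound) (c := 1)
    (fun hB _ h => (abs_le_of_sq_le_sq' (by simpa [sobEnergy] using h 0 (by simp))
      (by simpa using hB)).2) hB hρ hu h
  rwa [one_mul] at this

theorem sup_of_sobEnergy_le (hB : 0 ≤ B) (hρ : 0 ≤ ρ) (hu : SmoothPeriodic u)
    (h : ∀ k ≤ n + 2, sobEnergy k u ≤ (B * ρ ^ k) ^ 2) :
    DerivBound SupBound ρ n (3 * ρ * B) u := by
  refine of_sobEnergy_le (fun {B u} hB hu h p hp => ?_) hB hρ hu h
  have hu0 : l2norm u ≤ B :=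
    (abs_le_of_sq_le_sq' (by simpa [sobEnergy] using h 0 (by simp)) hB).2
  have hu2 : l2norm (Aop u) ≤ B * ρ ^ 2 := by
    refine (abs_le_of_sq_le_sq' ?_ (by positivity)).2
    have := h 2 le_rfl
    rwa [sobEnergy_add_two 0 hu] at this
  refine abs_le_of_sq_le_sq ?_ (by positivity)
  have := mul_le_mul hu0 hu2 (l2norm_nonneg _) hB
  nlinarith [agmon hu hp]

end DerivBound

section Nonlinearity

variable {u : ℝ × ℝ → ℝ} {j : ℕ} {L ρ : ℝ}

theorem l2norm_aop_iterate_cube_le (hu : SmoothPeriodic u) (hL : 0 ≤ L) (hρ : 1 ≤ ρ)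
    (h : ∀ k ≤ 2 * j + 2, sobEnergy k u ≤ (L * ρ ^ k) ^ 2) :
    l2norm (Aop^[j] (u * u * u)) ≤ 9 * (3 ^ j * 2 ^ (4 * j)) * (L ^ 3 * ρ ^ (2 * j + 2)) := by
  have hρ0 : 0 ≤ ρ := zero_le_one.trans hρ
  have hs := DerivBound.sup_of_sobEnergy_le hL hρ0 hu h
  have hl := DerivBound.l2_of_sobEnergy_le hL hρ0 hu h
  have h2 := DerivBound.mul_sup hu hu hs hs
  have h3 := DerivBound.mul_l2 (hu.mul hu) hu h2 hl
  refine (DerivBound.aop_iterate isSeminormBound_l2Bound hρ ((hu.mul hu).mul hu) j h3).trans_eq ?_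
  rw [mul_pow]
  ring

theorem l2norm_aop_iterate_gradDot_le (hu : SmoothPeriodic u) (hL : 0 ≤ L) (hρ : 1 ≤ ρ)
    (h : ∀ k ≤ 2 * j + 3, sobEnergy k u ≤ (L * ρ ^ k) ^ 2) :
    l2norm (Aop^[j] (gradDot u u)) ≤ 6 * (3 ^ j * 2 ^ (2 * j)) * (L ^ 2 * ρ ^ (2 * j + 3)) := by
  have hρ0 : 0 ≤ ρ := zero_le_one.trans hρ
  have hs := DerivBound.sup_of_sobEnergy_le (n := 2 * j + 1) hL hρ0 hu h
  have hl := DerivBound.l2_of_sobEnergy_le (n := 2 * j + 1) hL hρ0 hu h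
  have hx := DerivBound.mul_l2 hu.pdx hu.pdx hs.2.1 hl.2.1
  have hy := DerivBound.mul_l2 hu.pdy hu.pdy hs.2.2 hl.2.2
  have hxy := DerivBound.add isSeminormBound_l2Bound (hu.pdx.mul hu.pdx) (hu.pdy.mul hu.pdy) hx hy
  refine (DerivBound.aop_iterate isSeminormBound_l2Bound hρ (hu.gradDot hu) j hxy).trans_eq ?_
  rw [mul_pow]
  ring

theorem exists_sobEnergy_le (hu : SmoothPeriodic u) (n : ℕ) (h0 : 0 < l2norm u) :
    ∃ ρ ≥ 1, l2norm (Aop^[n + 1] u) = l2norm u * ρ ^ (2 * n + 2) ∧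
      ∀ k ≤ 2 * n + 2, sobEnergy k u ≤ (l2norm u * ρ ^ k) ^ 2 := by
  have hE := sobEnergy_two_mul (n + 1) hu
  have hle : l2norm u ≤ l2norm (Aop^[n + 1] u) := by
    refine (abs_le_of_sq_le_sq' ?_ (l2norm_nonneg _)).2
    rw [← hE]
    exact monotone_nat_of_le_succ (fun k => sobEnergy_le_succ k u) (zero_le : 0 ≤ 2 * (n + 1))
  have hr : 1 ≤ l2norm (Aop^[n + 1] u) / l2norm u := (one_le_div h0).2 hle
  refine ⟨(l2norm (Aop^[n + 1] u) / l2norm u) ^ (((2 * n + 2 : ℕ) : ℝ)⁻¹),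
    Real.one_le_rpow hr (by positivity), ?_, ?_⟩
  · rw [Real.rpow_inv_natCast_pow (by positivity) (by omega), mul_div_cancel₀ _ h0.ne']
  · set ρ := (l2norm (Aop^[n + 1] u) / l2norm u) ^ (((2 * n + 2 : ℕ) : ℝ)⁻¹) with hρ
    have hρ0 : 0 < ρ := Real.rpow_pos_of_pos (by positivity) _
    have hpow : ρ ^ (2 * n + 2) = l2norm (Aop^[n + 1] u) / l2norm u :=
      Real.rpow_inv_natCast_pow (by positivity) (by omega)
    intro k hk
    refine (le_of_logConvex (q := fun k => sobEnergy k u) (s := 2 * n + 2) (B := l2norm u ^ 2)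
      (r := ρ ^ 2) (by positivity) (by positivity) (fun k => sobEnergy_nonneg k u)
      (fun k => sobEnergy_sq_le k hu) le_rfl ?_ hk).trans_eq (by ring)
    rw [pow_right_comm, hpow, ← mul_pow, mul_div_cancel₀ _ h0.ne']
    exact hE.le

theorem sobEnergy_eq_zero (hu : SmoothPeriodic u) (h0 : l2norm u = 0) (k : ℕ) :
    sobEnergy k u = 0 := by
  induction k with
  | zero => simp [sobEnergy, h0]
  | succ k ih =>
    have := sobEnergy_sq_le k hu
    rw [ih, zero_mul] at this
    exact pow_eq_zero_iff two_ne_zero |>.1 (this.antisymm (sq_nonneg _))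

theorem mul_mul_pow_le {K x y δ : ℝ} (hK : 0 ≤ K) (hx : 0 ≤ x) (hy : 0 ≤ y) (hδ : 0 < δ) (n : ℕ) :
    K * x * y ^ n ≤ δ * y ^ (n + 1) + K * (K / δ) ^ n * x ^ (n + 1) := by
  rcases le_total (K * x) (δ * y) with h | h
  · have h1 := mul_le_mul_of_nonneg_right h (pow_nonneg hy n)
    have h2 : 0 ≤ K * (K / δ) ^ n * x ^ (n + 1) := by positivity
    rw [pow_succ' y n]
    linarith
  · have h1 : y ≤ K / δ * x := by
      rw [div_mul_eq_mul_div, le_div_iff₀ hδ]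
      linarith
    have h2 := mul_le_mul_of_nonneg_left (pow_le_pow_left₀ hy h1 n) (mul_nonneg hK hx)
    have h3 : 0 ≤ δ * y ^ (n + 1) := by positivity
    have h4 : K * x * (K / δ * x) ^ n = K * (K / δ) ^ n * x ^ (n + 1) := by
      rw [mul_pow]
      ring
    linarith

theorem fNL_eq (a b : ℝ) (u : ℝ × ℝ → ℝ) :
    fNL a b u = (a + 3) • u + (-4 : ℝ) • Aop u + b • gradDot u u + u * u * u := by
  funext p
  simp only [fNL, Pi.add_apply, Pi.smul_apply, Pi.mul_apply, smul_eq_mul]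
  ring

theorem SmoothPeriodic.fNL (a b : ℝ) (hu : SmoothPeriodic u) : SmoothPeriodic (fNL a b u) :=
  fNL_eq a b u ▸ (((hu.const_smul _).add (hu.aop.const_smul _)).add
    ((hu.gradDot hu).const_smul b)).add ((hu.mul hu).mul hu)

theorem l2inner_aop_iterate_fNL (a b : ℝ) (n : ℕ) (hu : SmoothPeriodic u) :
    l2inner (Aop^[n + 1] u) (Aop^[n + 1] (fNL a b u)) =
      (a + 3) * l2norm (Aop^[n + 1] u) ^ 2 -
        4 * l2inner (Aop^[n + 1] u) (Aop^[n + 2] u) +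
        b * l2inner (Aop^[n + 2] u) (Aop^[n] (gradDot u u)) +
        l2inner (Aop^[n + 2] u) (Aop^[n] (u * u * u)) := by
  have h1 := hu.const_smul (a + 3)
  have h2 := hu.aop.const_smul (-4)
  have h3 := (hu.gradDot hu).const_smul b
  have h4 := (hu.mul hu).mul hu
  have hc : ∀ {w : ℝ × ℝ → ℝ} (k : ℕ), SmoothPeriodic w → Continuous (Aop^[k] w) :=
    fun k hw => (hw.aop_iterate k).continuous
  have hmove : ∀ {w : ℝ × ℝ → ℝ}, SmoothPeriodic w →
      l2inner (Aop^[n + 1] u) (Aop^[n + 1] w) = l2inner (Aop^[n + 2] u) (Aop^[n] w) := by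
    intro w hw
    rw [Function.iterate_succ_apply' _ n w, ← l2inner_aop_comm (hu.aop_iterate _)
      (hw.aop_iterate _), ← Function.iterate_succ_apply' Aop]
  rw [fNL_eq, aop_iterate_add _ ((h1.add h2).add h3) h4, aop_iterate_add _ (h1.add h2) h3,
    aop_iterate_add _ h1 h2,
    l2inner_add_right (hc _ hu) (((hc _ h1).add (hc _ h2)).add (hc _ h3)) (hc _ h4),
    l2inner_add_right (hc _ hu) ((hc _ h1).add (hc _ h2)) (hc _ h3),
    l2inner_add_right (hc _ hu) (hc _ h1) (hc _ h2), aop_iterate_const_smul _ _ hu,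
    aop_iterate_const_smul _ _ hu.aop, aop_iterate_const_smul _ _ (hu.gradDot hu),
    l2inner_const_smul_right, l2inner_const_smul_right, l2inner_const_smul_right,
    hmove (hu.gradDot hu), hmove h4, ← Function.iterate_succ_apply, l2norm_sq]
  ring

end Nonlinearity

/-- Estimate for `|(A^m u, A^m f(u))|`. -/
theorem stmt_7 (a b : ℝ) (m : ℕ) (hm : 1 ≤ m) :
    ∀ ε > (0 : ℝ), ∃ c > 0, ∀ u : ℝ × ℝ → ℝ, SmoothPeriodic u →
      |l2inner (Aop^[m] u) (Aop^[m] (fNL a b u))| ≤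
        ε * l2norm (Aop^[m + 1] u) ^ 2 +
          c * (l2norm (Aop^[m] u) ^ 2 + l2norm u ^ (2 * (2 * m + 3)) + 1) := by
  intro ε hε
  obtain ⟨j, rfl⟩ : ∃ j, m = j + 1 := ⟨m - 1, by omega⟩
  set K₁ : ℝ := |b| * (6 * (3 ^ j * 2 ^ (2 * j))) with hK₁
  set K₂ : ℝ := 9 * (3 ^ j * 2 ^ (4 * j)) with hK₂
  have hK₁0 : 0 ≤ K₁ := by positivity
  have hK₂0 : 0 ≤ K₂ := by positivity
  set c₁ : ℝ := K₁ * (K₁ / (ε / 4)) ^ (4 * j + 7)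
  set c₂ : ℝ := K₂ * (K₂ / (ε / 4)) ^ (2 * j + 3)
  have hc₁ : 0 ≤ c₁ := by positivity
  have hc₂ : 0 ≤ c₂ := by positivity
  refine ⟨|a + 3| + 16 / ε + c₁ + c₂ + 1, by positivity, fun u hu => ?_⟩
  set L := l2norm u with hL
  set X := l2norm (Aop^[j + 1] u) with hX
  set E := l2norm (Aop^[j + 2] u) with hE
  have hL0 : 0 ≤ L := l2norm_nonneg _
  have hX0 : 0 ≤ X := l2norm_nonneg _
  have hE0 : 0 ≤ E := l2norm_nonneg _
  rcases hL0.eq_or_lt with h0 | hpos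
  · have hX' : X = 0 := by
      have := sobEnergy_two_mul (j + 1) hu
      rw [sobEnergy_eq_zero hu h0.symm] at this
      exact pow_eq_zero_iff two_ne_zero |>.1 this.symm
    have := abs_l2inner_le (hu.aop_iterate (j + 1)).continuous
      ((hu.fNL a b).aop_iterate (j + 1)).continuous
    rw [← hX, hX', zero_mul] at this
    exact this.trans (by positivity)
  obtain ⟨ρ, hρ, hEρ, hen⟩ := exists_sobEnergy_le hu (j + 1) hpos
  rw [← hL, ← hE] at hEρ
  have hρ0 : 0 ≤ ρ := zero_le_one.trans hρ
  have hcube := l2norm_aop_iterate_cube_le (j := j) hu hL0 hρ fun k hk => hen k (by omega)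
  have hgrad := l2norm_aop_iterate_gradDot_le (j := j) hu hL0 hρ fun k hk => hen k (by omega)
  have hcu := (hu.aop_iterate (j + 2)).continuous
  have i1 := abs_l2inner_le (hu.aop_iterate (j + 1)).continuous hcu
  have i2 := (abs_l2inner_le hcu ((hu.gradDot hu).aop_iterate j).continuous).trans
    (mul_le_mul_of_nonneg_left hgrad hE0)
  have i3 := (abs_l2inner_le hcu (((hu.mul hu).mul hu).aop_iterate j).continuous).trans
    (mul_le_mul_of_nonneg_left hcube hE0)
  rw [← hX, ← hE] at i1
  have hY : X * E * 4 ≤ ε / 2 * E ^ 2 + 16 / ε * X ^ 2 := by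
    have h1 : 16 / ε * X ^ 2 = 16 * X ^ 2 / ε := by ring
    rw [h1, ← sub_le_iff_le_add', le_div_iff₀ hε]
    nlinarith [sq_nonneg (ε * E - 4 * X), sq_nonneg X]
  have hG : |b| * (E * (6 * (3 ^ j * 2 ^ (2 * j)) * (L ^ 2 * ρ ^ (2 * j + 3)))) ≤
      ε / 4 * E ^ 2 + c₁ * L ^ (2 * (2 * (j + 1) + 3)) := by
    have := mul_le_mul_of_nonneg_left
      (mul_mul_pow_le hK₁0 hL0 hρ0 (δ := ε / 4) (by positivity) (4 * j + 7)) (sq_nonneg L)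
    rw [hEρ]
    calc _ = L ^ 2 * (K₁ * L * ρ ^ (4 * j + 7)) := by rw [hK₁]; ring
      _ ≤ _ := this
      _ = _ := by simp only [c₁]; ring
  have hC : E * (9 * (3 ^ j * 2 ^ (4 * j)) * (L ^ 3 * ρ ^ (2 * j + 2))) ≤
      ε / 4 * E ^ 2 + c₂ * L ^ (2 * (2 * (j + 1) + 3)) := by
    have := mul_le_mul_of_nonneg_left
      (mul_mul_pow_le hK₂0 (sq_nonneg L) (sq_nonneg ρ) (δ := ε / 4) (by positivity) (2 * j + 3))
      (sq_nonneg L)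
    rw [hEρ]
    calc _ = L ^ 2 * (K₂ * L ^ 2 * (ρ ^ 2) ^ (2 * j + 3)) := by rw [hK₂]; ring
      _ ≤ _ := this
      _ = _ := by simp only [c₂]; ring
  rw [l2inner_aop_iterate_fNL a b j hu]
  have hP : 0 ≤ L ^ (2 * (2 * (j + 1) + 3)) := by positivity
  have hb := mul_le_mul_of_nonneg_left i2 (abs_nonneg b)
  refine (abs_add_le _ _).trans ?_
  refine (add_le_add_left ((abs_add_le _ _).trans (add_le_add_left (abs_sub _ _) _)) _).trans ?_
  rw [abs_mul b, abs_mul 4, abs_mul (a + 3), abs_of_nonneg (sq_nonneg X),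
    abs_of_pos (four_pos : (0 : ℝ) < 4)]
  have r1 : 0 ≤ |a + 3| * (L ^ (2 * (2 * (j + 1) + 3)) + 1) := by positivity
  have r2 : 0 ≤ 16 / ε * (L ^ (2 * (2 * (j + 1) + 3)) + 1) := by positivity
  have r3 : 0 ≤ (c₁ + c₂) * (X ^ 2 + 1) := by positivity
  have r4 : 0 ≤ X ^ 2 + L ^ (2 * (2 * (j + 1) + 3)) + 1 := by positivity
  linarith
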